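/- Let C : f = 0 be a reduced plane curve of degree d in ℙ² which is not a union of lines through one point, and set T = 3(d−2). Then for every integer k one has dim_ℂ N(f)_k = m(f)_k + m(f)_{T−k} − m_s(k) − τ(C), where m(f)_j is interpreted as 0 for j < 0. -/

import Mathlib

open MvPolynomial

noncomputable section

/-- The polynomial ring `S = ℂ[x,y,z]`. -/
abbrev S : Type := MvPolynomial (Fin 3) ℂ

/-- The Jacobian ideal of `f`, spanned by the three partial derivatives. -/
def Jf (f : S) : Ideal S := Ideal.span {pderiv 0 f, pderiv 1 f, pderiv 2 f}

/-- The irrelevant maximal ideal `m = (x,y,z)`. -/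
def mId : Ideal S := Ideal.span {X 0, X 1, X 2}

/-- The saturation `I_f` of the Jacobian ideal with respect to `m`. -/
def Isat (f : S) : Ideal S := ⨆ n : ℕ, Submodule.colon (Jf f) ((mId ^ n : Ideal S) : Submodule S S)

/-- The quotient map `S → M(f) = S/J_f`, as a `ℂ`-linear map. -/
def quotC (f : S) : S →ₗ[ℂ] (S ⧸ (Jf f : Submodule S S)) :=
  ((Jf f : Submodule S S).mkQ).restrictScalars ℂ

/-- Degree-`k` homogeneous component of `S`, as a `ℂ`-subspace. -/
def Sgr (k : ℕ) : Submodule ℂ S := homogeneousSubmodule (Fin 3) ℂ k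

/-- The degree-`k` part of the Milnor algebra `M(f)`. -/
def Msub (f : S) (k : ℕ) : Submodule ℂ (S ⧸ (Jf f : Submodule S S)) := (Sgr k).map (quotC f)

/-- `m(f)_k`, the dimension of the degree-`k` part of the Milnor algebra. -/
def mdim (f : S) (k : ℕ) : ℕ := Module.finrank ℂ (Msub f k)

/-- The degree-`k` part of the Jacobian module `N(f) = I_f/J_f`, realized inside `S/J_f`. -/
def Nsub (f : S) (k : ℕ) : Submodule ℂ (S ⧸ (Jf f : Submodule S S)) :=
  (((Isat f).restrictScalars ℂ) ⊓ Sgr k).map (quotC f)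

/-- `dim_ℂ N(f)_k`. -/
def ndim (f : S) (k : ℕ) : ℕ := Module.finrank ℂ (Nsub f k)

/-- The Jacobian module `N(f) = I_f/J_f`, as an `S`-submodule of `S/J_f`. -/
def Nmod (f : S) : Submodule S (S ⧸ (Jf f : Submodule S S)) :=
  Submodule.map ((Jf f : Submodule S S).mkQ) (Isat f : Submodule S S)

/-- The Jacobian module `N(f)` as a `ℂ`-subspace of `S/J_f`. -/
def NsubTot (f : S) : Submodule ℂ (S ⧸ (Jf f : Submodule S S)) :=
  ((Isat f).restrictScalars ℂ).map (quotC f)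

/-- `dim_ℂ N(f)`. -/
def ndimTot (f : S) : ℕ := Module.finrank ℂ (NsubTot f)

/-- `C : f = 0` is nearly free: `N(f) ≠ 0` and `dim N(f)_k ≤ 1` for all `k`. -/
def NearlyFree (f : S) : Prop := Nmod f ≠ ⊥ ∧ ∀ k : ℕ, ndim f k ≤ 1

/-- `f` defines a union of lines passing through one point. -/
def IsConeOfLines (f : S) : Prop :=
  ∃ q : Fin 3 → ℂ, q ≠ 0 ∧ ∃ (c : ℂ) (L : Multiset S),
    (∀ l ∈ L, l ∈ Sgr 1 ∧ eval q l = 0) ∧ f = C c * L.prod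

/-- The defining equation map `(a,b,c) ↦ a f_x + b f_y + c f_z`. -/
def eqnMap (f : S) : (Fin 3 → S) →ₗ[S] S where
  toFun r := ∑ i, r i * pderiv i f
  map_add' a b := by simp [add_mul, Finset.sum_add_distrib]
  map_smul' c a := by simp [Finset.mul_sum, mul_assoc]

/-- `AR(f)`, the module of all relations among the partial derivatives of `f`. -/
def ARmod (f : S) : Submodule S (Fin 3 → S) := LinearMap.ker (eqnMap f)

/-- A triple of polynomials is homogeneous of degree `m` (componentwise). -/
def IsHomRel (r : Fin 3 → S) (m : ℕ) : Prop := ∀ i, r i ∈ Sgr m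

/-- The set of degrees of nonzero homogeneous relations in `AR(f)`;
its least element is `mdr(f)`. -/
def mdrSet (f : S) : Set ℕ := {m | ∃ r ∈ ARmod f, r ≠ 0 ∧ IsHomRel r m}

/-- The map `(u₁,u₂,u₃) ↦ u₁ r₁ + u₂ r₂ + u₃ r₃` whose kernel is the syzygy
module among `r₁, r₂, r₃`. -/
def syzMap (r : Fin 3 → (Fin 3 → S)) : (Fin 3 → S) →ₗ[S] (Fin 3 → S) where
  toFun u := ∑ j, u j • r j
  map_add' a b := by simp [add_smul, Finset.sum_add_distrib]
  map_smul' c a := by simp [Finset.smul_sum, smul_smul]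

/-- `M(f)` has a minimal graded free resolution
`0 → S(−b−2(d−1)) → ⊕ᵢ S(−dᵢ−(d−1)) → S(−d+1)³ → S`; equivalently, `AR(f)` is
generated by three homogeneous relations of degrees `d₁, d₂, d₃`, none lying in
the submodule spanned by the other two, whose syzygy module is free of rank one,
generated by a homogeneous triple `(v₁,v₂,v₃)` with `deg vᵢ = b − dᵢ + d − 1`. -/
def HasResolution (f : S) (d : ℕ) (dd : Fin 3 → ℕ) (b : ℤ) : Prop :=
  ∃ r : Fin 3 → (Fin 3 → S),
    (∀ j, r j ∈ ARmod f) ∧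
    (∀ j, IsHomRel (r j) (dd j)) ∧
    Submodule.span S (Set.range r) = ARmod f ∧
    (∀ j, r j ∉ Submodule.span S (r '' {k | k ≠ j})) ∧
    ∃ v : Fin 3 → S, v ≠ 0 ∧
      (∀ j, ∃ e : ℕ, (e : ℤ) = b - dd j + d - 1 ∧ v j ∈ Sgr e) ∧
      LinearMap.ker (syzMap r) = Submodule.span S {v}

/-- The Hilbert function of the Milnor algebra of a smooth plane curve of
degree `d`: the coefficient of `t^k` in `((1 − t^{d−1})/(1 − t))³`. -/
def msHilb (d k : ℕ) : ℕ :=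
  (((∑ i ∈ Finset.range (d - 1), (Polynomial.X : Polynomial ℕ) ^ i)) ^ 3).coeff k

/-- `τ` is the total Tjurina number of `C : f = 0`, i.e. the common value of
`m(f)_k` for all sufficiently large `k`. -/
def TjurinaIs (f : S) (τ : ℕ) : Prop := ∃ N : ℕ, ∀ k ≥ N, mdim f k = τ


/-- `m(f)_k` extended to integer indices (zero for negative `k`). -/
def mdimZ (f : S) (k : ℤ) : ℤ := if 0 ≤ k then (mdim f k.toNat : ℤ) else 0

/-- `dim_ℂ N(f)_k` extended to integer indices (zero for negative `k`). -/
def ndimZ (f : S) (k : ℤ) : ℤ := if 0 ≤ k then (ndim f k.toNat : ℤ) else 0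

/-- `m_s(k)` extended to integer indices (zero for negative `k`). -/
def msHilbZ (d : ℕ) (k : ℤ) : ℤ := if 0 ≤ k then (msHilb d k.toNat : ℤ) else 0

/-- integer graded piece of the polynomial ring -/
def Sz (k : ℤ) : Submodule ℂ S := if 0 ≤ k then Sgr k.toNat else ⊥

/-- integer graded projection -/
def hz (k : ℤ) : S →ₗ[ℂ] S := if 0 ≤ k then homogeneousComponent k.toNat else 0

lemma Sz_nat (n : ℕ) : Sz (n : ℤ) = homogeneousSubmodule (Fin 3) ℂ n := by
  simp [Sz, Sgr]

lemma Sz_neg {k : ℤ} (h : k < 0) : Sz k = ⊥ := by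
  simp [Sz, not_le.mpr h]

lemma hz_nat (n : ℕ) : hz (n : ℤ) = homogeneousComponent n := by
  simp [hz]

lemma hz_neg {k : ℤ} (h : k < 0) : hz k = 0 := by
  simp [hz, not_le.mpr h]

lemma int_cases (k : ℤ) : (∃ n : ℕ, k = n) ∨ k < 0 := by
  rcases lt_or_ge k 0 with h | h
  · exact Or.inr h
  · exact Or.inl ⟨k.toNat, by omega⟩

lemma hz_mem (k : ℤ) (p : S) : hz k p ∈ Sz k := by
  rcases int_cases k with ⟨n, rfl⟩ | h
  · rw [hz_nat, Sz_nat]; exact homogeneousComponent_mem n p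
  · simp [hz_neg h]

lemma hz_self {k : ℤ} {p : S} (hp : p ∈ Sz k) : hz k p = p := by
  rcases int_cases k with ⟨n, rfl⟩ | h
  · rw [Sz_nat] at hp; rw [hz_nat, homogeneousComponent_of_mem hp, if_pos rfl]
  · simp [Sz_neg h] at hp; simp [hp]

lemma hz_ne {j k : ℤ} {p : S} (hp : p ∈ Sz j) (h : j ≠ k) : hz k p = 0 := by
  rcases int_cases k with ⟨n, rfl⟩ | h'
  · rcases int_cases j with ⟨m, rfl⟩ | h'
    · rw [Sz_nat] at hp; rw [hz_nat, homogeneousComponent_of_mem hp, if_neg]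
      intro h2; exact h (by rw [h2])
    · simp [Sz_neg h'] at hp; simp [hp]
  · simp [hz_neg h']

lemma Sz_mul {i j : ℤ} {p q : S} (hp : p ∈ Sz i) (hq : q ∈ Sz j) : p * q ∈ Sz (i + j) := by
  rcases int_cases i with ⟨m, rfl⟩ | h
  · rcases int_cases j with ⟨n, rfl⟩ | h
    · rw [Sz_nat] at hp hq
      have : ((m : ℤ) + n) = ((m + n : ℕ) : ℤ) := by push_cast; rfl
      rw [this, Sz_nat]
      exact IsHomogeneous.mul hp hq
    · simp [Sz_neg h] at hq; simp [hq]
  · simp [Sz_neg h] at hp; simp [hp]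

lemma sum_hz (p : S) : ∑ i ∈ Finset.range (p.totalDegree + 1), hz (i : ℤ) p = p := by
  simp only [hz_nat]; exact sum_homogeneousComponent p

lemma hz_mul {e : ℤ} {g : S} (hg : g ∈ Sz e) (k : ℤ) (p : S) :
    hz k (p * g) = hz (k - e) p * g := by
  have key : ∀ i : ℤ, hz k (hz i p * g) = hz (k - e) (hz i p) * g := by
    intro i
    by_cases h : i = k - e
    · subst h
      rw [hz_self (hz_mem _ p)]
      apply hz_self
      have := Sz_mul (hz_mem (k - e) p) hg
      rwa [sub_add_cancel] at this
    · rw [hz_ne (hz_mem i p) h, hz_ne (Sz_mul (hz_mem i p) hg) (by omega), zero_mul]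
  conv_lhs => rw [← sum_hz p]
  conv_rhs => rw [← sum_hz p]
  rw [Finset.sum_mul, map_sum, map_sum, Finset.sum_mul]
  exact Finset.sum_congr rfl fun i _ => key i

lemma X_mem_Sz (i : Fin 3) : (X i : S) ∈ Sz 1 := by
  have := Sz_nat 1
  rw [Nat.cast_one] at this
  rw [this]; exact isHomogeneous_X ℂ i

lemma one_mem_Sz : (1 : S) ∈ Sz 0 := by
  have := Sz_nat 0
  rw [Nat.cast_zero] at this
  rw [this]; exact isHomogeneous_one _ _

instance Sz_fd (k : ℤ) : FiniteDimensional ℂ (Sz k) := by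
  rcases int_cases k with ⟨n, rfl⟩ | h
  · rw [Sz_nat]
    exact Module.Finite.iff_fg.mpr (homogeneousSubmodule_fg (Fin 3) ℂ n)
  · rw [Sz_neg h]; infer_instance

/-- dimension of the graded piece -/
def sg (k : ℤ) : ℤ := if 0 ≤ k then ((k.toNat + 2).choose 2 : ℕ) else 0

lemma finrank_Sz (k : ℤ) : (Module.finrank ℂ (Sz k) : ℤ) = sg k := by
  rcases int_cases k with ⟨n, rfl⟩ | h
  · rw [Sz_nat, homogeneousSubmodule_eq_finsupp_supported]
    have h1 := (AddMonoidAlgebra.supportedEquivFinsupp (R := ℂ) (S := ℂ)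
      {d : Fin 3 →₀ ℕ | d.degree = n}).finrank_eq
    have hS : {d : Fin 3 →₀ ℕ | d.degree = n}
      = ((Finset.univ : Finset (Fin 3)).finsuppAntidiag n : Set (Fin 3 →₀ ℕ)) := by
      ext d
      simp [Finset.mem_finsuppAntidiag, Finsupp.degree_eq_sum]
    have h2 : Module.finrank ℂ (({d : Fin 3 →₀ ℕ | d.degree = n} : Set (Fin 3 →₀ ℕ)) →₀ ℂ)
      = (n + 2).choose 2 := by
      rw [hS]
      have := Finset.card_finsuppAntidiag_nat_eq_choose (s := (Finset.univ : Finset (Fin 3))) n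
      rw [Module.finrank_finsupp_self, ← Nat.card_eq_fintype_card, Nat.card_coe_set_eq,
        Set.ncard_coe_finset, this, Finset.card_univ, Fintype.card_fin,
        show 3 + n - 1 = n + 2 by omega, Nat.choose_symm_add]
    rw [show Module.finrank ℂ _ = _ from h1, h2]
    simp [sg]
  · rw [Sz_neg h]; simp [sg, not_le.mpr h]

lemma sg_neg {k : ℤ} (h : k < 0) : sg k = 0 := by simp [sg, not_le.mpr h]

lemma sg_eq {k : ℤ} (h : -2 ≤ k) : 2 * sg k = (k + 2) * (k + 1) := by
  rcases int_cases k with ⟨n, rfl⟩ | h'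
  · simp only [sg, Int.natCast_nonneg, if_true, Int.toNat_natCast]
    have := Nat.triangle_succ (n + 1)
    have h2 := Nat.choose_two_right (n + 2)
    have h3 : 2 * (n + 2).choose 2 = (n + 2) * (n + 1) := by
      rw [h2]; exact Nat.mul_div_cancel' (by simpa using (Nat.even_mul_pred_self (n+2)).two_dvd)
    exact_mod_cast h3
  · have : k = -2 ∨ k = -1 := by omega
    rcases this with rfl | rfl <;> simp [sg]

lemma ms_eq (d : ℕ) (hd : 1 ≤ d) (k : ℤ) : msHilbZ d k =
    sg k - 3 * sg (k - (d - 1)) + 3 * sg (k - 2 * (d - 1)) - sg (k - 3 * (d - 1)) := by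
  obtain ⟨e, rfl⟩ : ∃ e, d = e + 1 := ⟨d - 1, by omega⟩
  rcases int_cases k with ⟨n, rfl⟩ | h'
  · simp only [msHilbZ, Int.natCast_nonneg, if_true, Int.toNat_natCast, msHilb, Nat.add_sub_cancel]
    set G : Polynomial ℕ := ∑ i ∈ Finset.range e, (Polynomial.X : Polynomial ℕ) ^ i with hG
    let W : PowerSeries ℤ := (PowerSeries.invOneSubPow ℤ 3).val
    have hW : W * (1 - PowerSeries.X) ^ 3 = 1 := by
      rw [← PowerSeries.invOneSubPow_inv_eq_one_sub_pow]; exact Units.val_inv _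
    have hGs : (∑ i ∈ Finset.range e, (PowerSeries.X : PowerSeries ℤ) ^ i) * (1 - PowerSeries.X)
      = 1 - PowerSeries.X ^ e := geom_sum_mul_neg _ _
    have h1 : (((G.map (Nat.castRingHom ℤ) : Polynomial ℤ) : PowerSeries ℤ)) =
      ∑ i ∈ Finset.range e, (PowerSeries.X : PowerSeries ℤ) ^ i := by
      rw [hG, Polynomial.map_sum, ← Polynomial.coeToPowerSeries.ringHom_apply, map_sum]
      simp
    have h2 : ((((G ^ 3).map (Nat.castRingHom ℤ) : Polynomial ℤ) : PowerSeries ℤ)) =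
      W - 3 * (PowerSeries.X ^ e * W) + 3 * (PowerSeries.X ^ (2 * e) * W)
        - PowerSeries.X ^ (3 * e) * W := by
      rw [Polynomial.map_pow, Polynomial.coe_pow, h1]
      set Q := ∑ i ∈ Finset.range e, (PowerSeries.X : PowerSeries ℤ) ^ i
      calc Q ^ 3 = Q ^ 3 * (W * (1 - PowerSeries.X) ^ 3) := by rw [hW, mul_one]
        _ = (Q * (1 - PowerSeries.X)) ^ 3 * W := by ring
        _ = _ := by rw [hGs]; ring
    have h3 := congrArg (PowerSeries.coeff n) h2
    have hc : ∀ m : ℕ, PowerSeries.coeff n (PowerSeries.X ^ m * W) = sg ((n : ℤ) - m) := by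
      intro m
      rw [PowerSeries.coeff_X_pow_mul']
      split_ifs with h
      · have : ((n : ℤ) - m) = ((n - m : ℕ) : ℤ) := by omega
        rw [this]
        simp only [sg, Int.natCast_nonneg, if_true, Int.toNat_natCast]
        have : W = PowerSeries.mk fun n => ((2 + n).choose 2 : ℤ) := by
          exact PowerSeries.invOneSubPow_val_succ_eq_mk_add_choose ℤ 2
        rw [this, PowerSeries.coeff_mk, add_comm]
      · rw [sg_neg (by omega)]
    have hc0 : PowerSeries.coeff n W = sg n := by simpa using hc 0
    have h3' : ∀ w : PowerSeries ℤ, PowerSeries.coeff n (3 * w) = 3 * PowerSeries.coeff n w := by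
      intro w
      have : (3 : PowerSeries ℤ) = PowerSeries.C (3 : ℤ) := by simp
      rw [this, PowerSeries.coeff_C_mul]
    rw [Polynomial.coeff_coe, Polynomial.coeff_map] at h3
    simp only [map_sub, map_add, h3', hc, hc0] at h3
    simp only [eq_natCast] at h3
    rw [h3]; push_cast; ring_nf
  · have h4 : (0 : ℤ) ≤ ((e + 1 : ℕ) : ℤ) - 1 := by push_cast; omega
    rw [sg_neg h', sg_neg (by omega), sg_neg (by omega), sg_neg (by omega)]
    simp [msHilbZ, not_le.mpr h']

lemma relprime_syz {a b α β : S} (h : IsRelPrime a b) (ha : a ≠ 0) (hr : α * a + β * b = 0) :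
    ∃ q, α = q * b ∧ β = - q * a := by
  have h1 : a ∣ β * b := ⟨-α, by linear_combination hr⟩
  obtain ⟨q, hq⟩ := h.dvd_of_dvd_mul_right h1
  refine ⟨-q, ?_, by rw [hq]; ring⟩
  apply mul_right_cancel₀ ha
  rw [hq] at hr
  linear_combination hr

lemma X2_mul_mem {q u v : S} (h : X 2 * q = X 0 * u + X 1 * v) :
    ∃ s r : S, q = X 0 * s + X 1 * r := by
  let θ : S →ₐ[ℂ] S := aeval ![0, 0, X 2]
  have h1 : ∀ p : S, p - θ p ∈ Ideal.span {(X 0 : S), X 1} := by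
    intro p
    induction p using MvPolynomial.induction_on with
    | C c => simp [θ]
    | add p q hp hq =>
      rw [map_add, add_sub_add_comm]; exact Ideal.add_mem _ hp hq
    | mul_X p i hp =>
      have : p * X i - θ (p * X i) = (p - θ p) * X i + θ p * (X i - θ (X i)) := by
        rw [map_mul]; ring
      rw [this]
      refine Ideal.add_mem _ (Ideal.mul_mem_right _ _ hp) (Ideal.mul_mem_left _ _ ?_)
      fin_cases i
      · simp [θ]; exact Ideal.subset_span (by simp)
      · simp [θ]; exact Ideal.subset_span (by simp)
      · simp [θ]
  have h2 : θ q = 0 := by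
    have := congrArg θ h
    simp only [map_add, map_mul] at this
    have h0 : θ (X 0) = 0 := by simp [θ]
    have h1 : θ (X 1) = 0 := by simp [θ]
    have h2 : θ (X 2) = X 2 := by simp [θ]
    rw [h0, h1, h2, zero_mul, zero_mul, add_zero] at this
    exact (mul_eq_zero.mp this).resolve_left (X_ne_zero 2)
  have h3 := h1 q
  rw [h2, sub_zero, Ideal.mem_span_pair] at h3
  obtain ⟨s, r, h3⟩ := h3
  exact ⟨s, r, by rw [← h3]; ring⟩

lemma X_dvd_of_X_mul {i j : Fin 3} (hij : i ≠ j) {u v : S} (h : X i * u = X j * v) :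
    (X j : S) ∣ u := by
  have hp : Prime (X j : S) := X_prime
  have : (X j : S) ∣ X i * u := ⟨v, h⟩
  rcases hp.dvd_or_dvd this with h1 | h1
  · rw [X_dvd_X] at h1
    rcases h1 with h1 | h1 <;> simp_all
  · exact h1

lemma depth_lemma {a b p : S} (h : IsRelPrime a b) (ha : a ≠ 0)
    (hp : ∀ i, X i * p ∈ Ideal.span {a, b}) : p ∈ Ideal.span {a, b} := by
  simp only [Ideal.mem_span_pair] at hp ⊢
  choose α β hαβ using hp
  obtain ⟨q01, h01, h01'⟩ := relprime_syz (α := X 1 * α 0 - X 0 * α 1)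
    (β := X 1 * β 0 - X 0 * β 1) h ha (by
      linear_combination X 1 * hαβ 0 - X 0 * hαβ 1)
  obtain ⟨q12, h12, h12'⟩ := relprime_syz (α := X 2 * α 1 - X 1 * α 2)
    (β := X 2 * β 1 - X 1 * β 2) h ha (by
      linear_combination X 2 * hαβ 1 - X 1 * hαβ 2)
  obtain ⟨q20, h20, h20'⟩ := relprime_syz (α := X 0 * α 2 - X 2 * α 0)
    (β := X 0 * β 2 - X 2 * β 0) h ha (by
      linear_combination X 0 * hαβ 2 - X 2 * hαβ 0)
  have hk : X 2 * q01 = X 0 * (-q12) + X 1 * (-q20) := by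
    apply mul_right_cancel₀ ha
    linear_combination X 2 * h01' + X 0 * h12' + X 1 * h20'
  obtain ⟨s, r, hq⟩ := X2_mul_mem hk
  have e1 : X 1 * (α 0 - r * b) = X 0 * (α 1 + s * b) := by
    rw [hq] at h01; linear_combination h01
  have e2 : X 1 * (β 0 + r * a) = X 0 * (β 1 - s * a) := by
    rw [hq] at h01'; linear_combination h01'
  obtain ⟨u, hu⟩ := X_dvd_of_X_mul (by decide) e1
  obtain ⟨v, hv⟩ := X_dvd_of_X_mul (by decide) e2
  refine ⟨u, v, ?_⟩
  apply mul_left_cancel₀ (X_ne_zero (R := ℂ) (0 : Fin 3))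
  linear_combination hαβ 0 - a * hu - b * hv

/-- the generic linear form -/
def ell (t : ℂ) : S := X 2 + C t * X 0 + C (t ^ 2) * X 1

lemma ell_finite (P : Ideal S) (hP : ∃ i, (X i : S) ∉ P) : {t : ℂ | ell t ∈ P}.Finite := by
  by_contra hinf
  have hinf : {t : ℂ | ell t ∈ P}.Infinite := hinf
  obtain ⟨t1, h1⟩ := hinf.nonempty
  obtain ⟨t2, h2, h21⟩ := hinf.exists_notMem_finset {t1}
  obtain ⟨t3, h3, h31⟩ := hinf.exists_notMem_finset {t1, t2}
  simp only [Set.mem_ofPred_eq, Finset.mem_singleton, Finset.mem_insert, not_or] at *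
  have cancel : ∀ (c : ℂ) (w : S), c ≠ 0 → C c * w ∈ P → w ∈ P := by
    intro c w hc hw
    have := P.mul_mem_left (C c⁻¹) hw
    rwa [← mul_assoc, ← C_mul, inv_mul_cancel₀ hc, C_1, one_mul] at this
  have key : ∀ t s, t ≠ s → ell t ∈ P → ell s ∈ P → X 0 + C (t + s) * X 1 ∈ P := by
    intro t s hts ht hs
    apply cancel (t - s) _ (sub_ne_zero.mpr hts)
    have := P.sub_mem ht hs
    convert this using 1
    simp only [ell, C_sub, C_add, C_pow]; ring
  have k1 := key t2 t1 h21 h2 h1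
  have k2 := key t3 t1 h31.1 h3 h1
  have x1 : (X 1 : S) ∈ P := by
    apply cancel (t3 - t2) _ (sub_ne_zero.mpr h31.2)
    have := P.sub_mem k2 k1
    convert this using 1
    simp only [C_sub, C_add]; ring
  have x0 : (X 0 : S) ∈ P := by
    have := P.sub_mem k1 (P.mul_mem_left (C (t2 + t1)) x1)
    simpa using this
  have x2 : (X 2 : S) ∈ P := by
    have := P.sub_mem (P.sub_mem h1 (P.mul_mem_left (C t1) x0)) (P.mul_mem_left (C (t1 ^ 2)) x1)
    convert this using 1
    simp only [ell]; ring
  obtain ⟨i, hi⟩ := hP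
  fin_cases i
  · exact hi x0
  · exact hi x1
  · exact hi x2

lemma exists_ell {a b : S} (h : IsRelPrime a b) (ha : a ≠ 0) :
    ∃ t : ℂ, ∀ p, ell t * p ∈ Ideal.span {a, b} → p ∈ Ideal.span {a, b} := by
  set I := Ideal.span {a, b} with hI
  have hfin := associatedPrimes.finite S (S ⧸ I)
  have hbad : (⋃ P ∈ associatedPrimes S (S ⧸ I), {t : ℂ | ell t ∈ P}).Finite := by
    apply hfin.biUnion
    intro P hP
    apply ell_finite
    by_contra! hall
    rw [AssociatedPrimes.mem_iff, isAssociatedPrime_iff] at hP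
    obtain ⟨hPp, x, hx⟩ := hP
    obtain ⟨p, rfl⟩ := Ideal.Quotient.mk_surjective x
    have hmem : ∀ r : S, r ∈ P ↔ r * p ∈ I := by
      intro r
      rw [hx, Submodule.mem_colon_singleton, Submodule.mem_bot, ← Ideal.Quotient.eq_zero_iff_mem]
      rw [map_mul]; rfl
    have hpI : p ∈ I := depth_lemma h ha fun i => (hmem _).mp (hall i)
    exact hPp.ne_top ((Ideal.eq_top_iff_one P).mpr ((hmem 1).mpr (by rwa [one_mul])))
  obtain ⟨t, ht⟩ := hbad.exists_notMem
  refine ⟨t, fun p hp => ?_⟩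
  by_contra hpI
  have : ell t ∈ ⋃ P ∈ associatedPrimes S (S ⧸ I), (P : Set S) := by
    rw [biUnion_associatedPrimes_eq_zero_divisors]
    refine ⟨Ideal.Quotient.mk I p, fun h0 => hpI (Ideal.Quotient.eq_zero_iff_mem.mp h0), ?_⟩
    have := Ideal.Quotient.eq_zero_iff_mem.mpr hp
    rw [map_mul] at this
    exact this
  apply ht
  simpa using this

lemma exists_comb {g0 g1 g2 : S} (h0 : g0 ≠ 0)
    (hc : ∀ p : S, Prime p → ¬ (p ∣ g0 ∧ p ∣ g1 ∧ p ∣ g2)) :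
    ∃ s : ℂ, IsRelPrime g0 (g1 + C s * g2) := by
  classical
  have hfin : (⋃ p ∈ (UniqueFactorizationMonoid.factors g0).toFinset,
      {s : ℂ | p ∣ g1 + C s * g2}).Finite := by
    apply Set.Finite.biUnion (Finset.finite_toSet _)
    intro p hp
    simp only [Finset.mem_coe, Multiset.mem_toFinset] at hp
    apply Set.Subsingleton.finite
    intro s hs s' hs'
    by_contra hne
    have hpp := UniqueFactorizationMonoid.prime_of_factor p hp
    have hd : p ∣ C (s - s') * g2 := by
      have := dvd_sub hs hs'
      convert this using 1
      rw [C_sub]; ring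
    have hg2 : p ∣ g2 := by
      have := hd.mul_left (C (s - s')⁻¹)
      rwa [← mul_assoc, ← C_mul, inv_mul_cancel₀ (sub_ne_zero.mpr hne), C_1, one_mul] at this
    have hg1 : p ∣ g1 := (dvd_add_left (hg2.mul_left (C s))).mp hs
    exact hc p hpp ⟨UniqueFactorizationMonoid.dvd_of_mem_factors hp, hg1, hg2⟩
  obtain ⟨s, hs⟩ := hfin.exists_notMem
  refine ⟨s, ?_⟩
  apply WfDvdMonoid.isRelPrime_of_no_irreducible_factors
  · exact fun h => h0 h.1
  · intro z hz hz0 hz1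
    obtain ⟨q, hq, hzq⟩ := UniqueFactorizationMonoid.exists_mem_factors_of_dvd h0 hz hz0
    apply hs
    simp only [Set.mem_iUnion]
    exact ⟨q, by simpa using hq, hzq.symm.dvd.trans hz1⟩

lemma pderiv_zero_of_dvd {g : S} {i : Fin 3} (h : g ∣ pderiv i g) : pderiv i g = 0 := by
  by_contra hne
  obtain ⟨k, hk⟩ := h
  have hg : g ≠ 0 := by rintro rfl; simp at hne
  have hk0 : k ≠ 0 := by rintro rfl; simp at hk; exact hne hk
  have h1 : g.totalDegree ≤ (pderiv i g).totalDegree := by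
    rw [hk, totalDegree_mul_of_isDomain hg hk0]; omega
  have hsupp : (pderiv i g).support.Nonempty := by simpa [Finset.nonempty_iff_ne_empty] using hne
  obtain ⟨m, hm, hm'⟩ := Finset.exists_mem_eq_sup _ hsupp (fun s : Fin 3 →₀ ℕ => s.sum fun _ e => e)
  have h2 : (pderiv i g).totalDegree = m.sum fun _ e => e := hm'
  have hm2 : m + Finsupp.single i 1 ∈ g.support := by
    rw [mem_support_iff] at hm ⊢
    rw [coeff_pderiv] at hm
    intro h0; rw [h0] at hm; simp at hm
  have h3 := le_totalDegree hm2
  rw [Finsupp.sum_add_index' (by simp) (by simp)] at h3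
  simp at h3
  omega

lemma unit_of_pderiv {g : S} (hg : g ≠ 0) (h : ∀ i, pderiv i g = 0) : IsUnit g := by
  have h1 : g = C (coeff 0 g) := by
    ext m
    rw [coeff_C]
    split_ifs with hm
    · rw [hm]
    · have : ∃ i, m i ≠ 0 := by
        by_contra! hall
        exact hm (Finsupp.ext fun i => (hall i).symm ▸ rfl)
      obtain ⟨i, hi⟩ := this
      have h2 := congrArg (coeff (m - Finsupp.single i 1)) (h i)
      rw [coeff_pderiv, coeff_zero] at h2
      have h3 : m - Finsupp.single i 1 + Finsupp.single i 1 = m := by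
        ext j
        by_cases hj : j = i
        · subst hj; simp; omega
        · simp [Ne.symm hj]
      rw [h3] at h2
      rcases mul_eq_zero.mp h2 with h4 | h4
      · exact h4
      · exfalso; exact (Nat.cast_add_one_ne_zero _) h4
  rw [h1]
  have : coeff 0 g ≠ 0 := by
    intro h0; rw [h0, C_0] at h1; exact hg h1
  exact (IsUnit.mk0 _ this).map C

lemma no_common_prime {f : S} {d : ℕ} (hd : 1 ≤ d) (hhom : f.IsHomogeneous d)
    (hred : Squarefree f) {g : S} (hg : Prime g) (h : ∀ i, g ∣ pderiv i f) : False := by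
  have hE := hhom.sum_X_mul_pderiv
  have hdf : g ∣ (d : S) * f := by
    rw [← nsmul_eq_mul, ← hE]
    exact Finset.dvd_sum fun i _ => (h i).mul_left _
  have hgf : g ∣ f := by
    rcases hg.dvd_or_dvd hdf with h1 | h1
    · exfalso
      have : IsUnit (d : S) := by
        have h2 : (d : S) = C (d : ℂ) := by simp
        rw [h2]
        exact (IsUnit.mk0 _ (by exact_mod_cast (by omega : d ≠ 0))).map C
      exact hg.not_isUnit (isUnit_of_dvd_unit h1 this)
    · exact h1
  obtain ⟨k, rfl⟩ := hgf
  have hk : ¬ g ∣ k := fun ⟨k', hk'⟩ => hg.not_isUnit (hred g ⟨k', by rw [hk']; ring⟩)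
  apply hg.not_isUnit
  apply unit_of_pderiv hg.ne_zero
  intro i
  apply pderiv_zero_of_dvd
  have h1 := h i
  rw [pderiv_mul] at h1
  have h2 : g ∣ pderiv i g * k := (dvd_add_left (Dvd.intro _ rfl)).mp h1
  exact (hg.dvd_or_dvd h2).resolve_right hk

lemma finrank_map_inf {V V' : Type*} [AddCommGroup V] [Module ℂ V] [AddCommGroup V'] [Module ℂ V']
    (g : V →ₗ[ℂ] V') (W : Submodule ℂ V) [FiniteDimensional ℂ W] :
    Module.finrank ℂ (W.map g) + Module.finrank ℂ (W ⊓ LinearMap.ker g : Submodule ℂ V)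
      = Module.finrank ℂ W := by
  have h := LinearMap.finrank_range_add_finrank_ker (g.domRestrict W)
  rw [LinearMap.range_domRestrict] at h
  have hk : W ⊓ LinearMap.ker g = Submodule.map W.subtype (LinearMap.ker (g.domRestrict W)) := by
    ext x
    constructor
    · rintro ⟨h1, h2⟩
      exact ⟨⟨x, h1⟩, h2, rfl⟩
    · rintro ⟨⟨y, hy⟩, h2, rfl⟩
      exact ⟨hy, h2⟩
  rw [hk, Submodule.finrank_map_subtype_eq, ← h]

/-- the data of two coprime forms together with a good linear form -/
structure Setup (a b : S) (e : ℤ) (t : ℂ) : Prop where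
  he : 1 ≤ e
  ha : a ∈ Sz e
  hb : b ∈ Sz e
  ha0 : a ≠ 0
  hb0 : b ≠ 0
  hab : IsRelPrime a b
  ht : ∀ p, ell t * p ∈ Ideal.span {a, b} → p ∈ Ideal.span {a, b}

/-- the ideal of the affine scheme -/
def Bi (a b : S) (t : ℂ) : Ideal S := Ideal.span {a, b, ell t - 1}

/-- the coordinate ring of the affine scheme -/
abbrev Bq (a b : S) (t : ℂ) : Type := S ⧸ Bi a b t

/-- dehomogenization -/
def rho (a b : S) (t : ℂ) : S →ₐ[ℂ] Bq a b t := Ideal.Quotient.mkₐ ℂ (Bi a b t)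

/-- filtration -/
def F (a b : S) (t : ℂ) (n : ℤ) : Submodule ℂ (Bq a b t) := (Sz n).map (rho a b t).toLinearMap

lemma mem_F {a b : S} {t : ℂ} {n : ℤ} {x : Bq a b t} :
    x ∈ F a b t n ↔ ∃ p ∈ Sz n, rho a b t p = x := Iff.rfl

lemma rho_surj {a b : S} {t : ℂ} (x : Bq a b t) : ∃ p, rho a b t p = x :=
  Ideal.Quotient.mk_surjective x

lemma rho_eq_zero {a b : S} {t : ℂ} {p : S} : rho a b t p = 0 ↔ p ∈ Bi a b t :=
  Ideal.Quotient.eq_zero_iff_mem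

lemma rho_I0 {a b : S} {t : ℂ} {p : S} (hp : p ∈ Ideal.span {a, b}) : rho a b t p = 0 := by
  rw [rho_eq_zero]
  exact Ideal.span_mono (by intro x hx; simp at hx ⊢; tauto) hp

lemma rho_ell {a b : S} {t : ℂ} : rho a b t (ell t) = 1 := by
  have : rho a b t (ell t - 1) = 0 := by
    rw [rho_eq_zero]; exact Ideal.subset_span (by simp)
  rw [map_sub, map_one] at this
  exact sub_eq_zero.mp this

lemma C_mul_Sz {n : ℤ} (c : ℂ) {p : S} (hp : p ∈ Sz n) : C c * p ∈ Sz n := by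
  rw [← smul_eq_C_mul]; exact Submodule.smul_mem _ _ hp

lemma ell_mem (t : ℂ) : ell t ∈ Sz 1 :=
  Submodule.add_mem _ (Submodule.add_mem _ (X_mem_Sz 2) (C_mul_Sz _ (X_mem_Sz 0)))
    (C_mul_Sz _ (X_mem_Sz 1))

lemma ell_mul_mem (t : ℂ) {n : ℤ} {p : S} (hp : p ∈ Sz n) : ell t * p ∈ Sz (n + 1) := by
  rw [mul_comm]; exact Sz_mul hp (ell_mem t)

/-- substitution killing the linear form -/
def pim (t : ℂ) : S →ₐ[ℂ] S := aeval ![X 0, X 1, -(C t * X 0 + C (t ^ 2) * X 1)]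

lemma pim_0 (t : ℂ) : pim t (X 0) = X 0 := by simp [pim]
lemma pim_1 (t : ℂ) : pim t (X 1) = X 1 := by simp [pim]
lemma pim_2 (t : ℂ) : pim t (X 2) = -(C t * X 0 + C (t ^ 2) * X 1) := by simp [pim]
lemma pim_C (t c : ℂ) : pim t (C c) = C c := (pim t).commutes c
lemma pim_ell (t : ℂ) : pim t (ell t) = 0 := by
  simp only [ell, map_add, map_mul, pim_0, pim_1, pim_2, pim_C]; ring

lemma pim_sub (t : ℂ) (p : S) : ∃ r, p = pim t p + ell t * r := by
  induction p using MvPolynomial.induction_on with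
  | C c => exact ⟨0, by rw [pim_C]; ring⟩
  | add p q hp hq =>
    obtain ⟨r, hr⟩ := hp
    obtain ⟨s, hs⟩ := hq
    exact ⟨r + s, by rw [map_add]; linear_combination hr + hs⟩
  | mul_X p i hp =>
    obtain ⟨r, hr⟩ := hp
    have : ∃ s, X i = pim t (X i) + ell t * s := by
      fin_cases i
      · exact ⟨0, by simp [pim_0]⟩
      · exact ⟨0, by simp [pim_1]⟩
      · exact ⟨1, by
          change X 2 = pim t (X 2) + _
          rw [pim_2, ell]; ring⟩
    obtain ⟨s, hs⟩ := this
    refine ⟨r * X i + pim t p * s, ?_⟩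
    rw [map_mul]
    linear_combination X i * hr + pim t p * hs

section setup
variable {a b : S} {e : ℤ} {t : ℂ}

lemma Setup.pair_hom (H : Setup a b e t) {n : ℤ} {p : S} (hp : p ∈ Sz n)
    (h : p ∈ Ideal.span {a, b}) : ∃ α ∈ Sz (n - e), ∃ β ∈ Sz (n - e), p = α * a + β * b := by
  rw [Ideal.mem_span_pair] at h
  obtain ⟨α, β, h⟩ := h
  refine ⟨hz (n - e) α, hz_mem _ _, hz (n - e) β, hz_mem _ _, ?_⟩
  rw [← hz_mul H.ha, ← hz_mul H.hb, ← map_add, h, hz_self hp]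

lemma Setup.I0_hom (H : Setup a b e t) {p : S} (h : p ∈ Ideal.span {a, b}) (n : ℤ) :
    hz n p ∈ Ideal.span {a, b} := by
  rw [Ideal.mem_span_pair] at h ⊢
  obtain ⟨α, β, h⟩ := h
  refine ⟨hz (n - e) α, hz (n - e) β, ?_⟩
  rw [← hz_mul H.ha, ← hz_mul H.hb, ← map_add, h]

lemma Setup.ker (H : Setup a b e t) {n : ℤ} {p : S} (hp : p ∈ Sz n) (h : rho a b t p = 0) :
    p ∈ Ideal.span {a, b} := by
  rw [rho_eq_zero, Bi, Ideal.mem_span_insert] at h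
  obtain ⟨α, z, hz', h⟩ := h
  rw [Ideal.mem_span_pair] at hz'
  obtain ⟨β, γ, hγ⟩ := hz'
  have hI : p - (γ * ell t - γ) ∈ Ideal.span {a, b} := by
    rw [Ideal.mem_span_pair]
    exact ⟨α, β, by rw [h, ← hγ]; ring⟩
  have hk : ∀ i : ℤ, hz i p - (hz (i - 1) γ * ell t - hz i γ) ∈ Ideal.span {a, b} := by
    intro i
    have := H.I0_hom hI i
    rwa [map_sub, map_sub, hz_mul (ell_mem t)] at this
  have h1 : ∀ j : ℕ, (j : ℤ) - 1 < n → hz ((j : ℤ) - 1) γ ∈ Ideal.span {a, b} := by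
    intro j
    induction j with
    | zero => intro _; rw [hz_neg (by norm_num)]; simp
    | succ j ih =>
      intro hj
      push_cast at hj ⊢
      rw [add_sub_cancel_right] at hj ⊢
      have h2 := hk j
      rw [hz_ne hp (by omega)] at h2
      have h3 := ih (by omega)
      have := Ideal.add_mem _ h2 (Ideal.mul_mem_left _ (ell t) h3)
      convert this using 1; ring
  have h2 : ∀ j : ℕ, hz (n + j) γ ∈ Ideal.span {a, b} → hz n γ ∈ Ideal.span {a, b} := by
    intro j
    induction j with
    | zero => intro h; simpa using h
    | succ j ih =>
      intro hj
      apply ih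
      apply H.ht
      have h2 := hk (n + (j + 1 : ℕ))
      rw [hz_ne hp (by push_cast; omega)] at h2
      have h4 : n + ((j + 1 : ℕ) : ℤ) - 1 = n + j := by push_cast; ring
      rw [h4] at h2
      have := Ideal.sub_mem _ hj h2
      convert this using 1; ring
  rcases int_cases n with ⟨m, rfl⟩ | hn
  · have h3 : hz (m : ℤ) γ ∈ Ideal.span {a, b} := by
      apply h2 (γ.totalDegree + 1)
      have : ((m : ℤ) + (γ.totalDegree + 1 : ℕ)) = ((m + (γ.totalDegree + 1) : ℕ) : ℤ) := by
        push_cast; rfl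
      rw [this, hz_nat, homogeneousComponent_eq_zero _ _ (by omega)]
      simp
    have h4 := hk m
    have h5 := h1 m (by omega)
    rw [hz_self hp] at h4
    have := Ideal.add_mem _ h4 (Ideal.sub_mem _ (Ideal.mul_mem_left _ (ell t) h5) h3)
    convert this using 1; ring
  · rw [Sz_neg hn] at hp
    rw [(Submodule.mem_bot _).mp hp]; simp

instance F_fd (n : ℤ) : FiniteDimensional ℂ (F a b t n) := by
  unfold F; infer_instance

lemma F_neg {n : ℤ} (hn : n < 0) : F a b t n = ⊥ := by
  rw [F, Sz_neg hn, Submodule.map_bot]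

lemma F_succ (n : ℤ) : F a b t n ≤ F a b t (n + 1) := by
  rintro _ ⟨p, hp, rfl⟩
  refine mem_F.mpr ⟨ell t * p, ell_mul_mem t hp, ?_⟩
  rw [map_mul, rho_ell, one_mul]; rfl

lemma F_mono {m n : ℤ} (h : m ≤ n) : F a b t m ≤ F a b t n := by
  obtain ⟨j, rfl⟩ : ∃ j : ℕ, n = m + j := ⟨(n - m).toNat, by omega⟩
  clear h
  induction j with
  | zero => simp
  | succ j ih =>
    refine ih.trans ?_
    have := F_succ (a := a) (b := b) (t := t) (m + j)
    push_cast; rwa [← add_assoc]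

lemma F_mul {m n : ℤ} {x y : Bq a b t} (hx : x ∈ F a b t m) (hy : y ∈ F a b t n) :
    x * y ∈ F a b t (m + n) := by
  obtain ⟨p, hp, rfl⟩ := mem_F.mp hx
  obtain ⟨q, hq, rfl⟩ := mem_F.mp hy
  exact mem_F.mpr ⟨p * q, Sz_mul hp hq, map_mul _ _ _⟩

lemma one_mem_F : (1 : Bq a b t) ∈ F a b t 0 := mem_F.mpr ⟨1, one_mem_Sz, map_one _⟩

lemma mem_some_F (x : Bq a b t) : ∃ n : ℕ, x ∈ F a b t n := by
  obtain ⟨p, rfl⟩ := rho_surj x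
  refine ⟨p.totalDegree, ?_⟩
  rw [← sum_hz p, map_sum]
  apply Submodule.sum_mem
  intro i hi
  rw [sum_hz p]
  have : (i : ℤ) ≤ p.totalDegree := by
    have := Finset.mem_range.mp hi
    omega
  exact F_mono this (mem_F.mpr ⟨_, hz_mem _ _, rfl⟩)

lemma finrank_map_mul {g : S} (hg : g ≠ 0) (n : ℤ) :
    (Module.finrank ℂ ((Sz n).map (LinearMap.mulRight ℂ g)) : ℤ) = sg n := by
  rw [← finrank_Sz]
  congr 1
  exact (Submodule.equivMapOfInjective (LinearMap.mulRight ℂ g)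
    (mul_left_injective₀ hg) (Sz n)).finrank_eq.symm

lemma Setup.finrank_I0 (H : Setup a b e t) (n : ℤ) :
    (Module.finrank ℂ (Sz n ⊓ LinearMap.ker (rho a b t).toLinearMap : Submodule ℂ S) : ℤ)
      = 2 * sg (n - e) - sg (n - 2 * e) := by
  set U := (Sz (n - e)).map (LinearMap.mulRight ℂ a) with hU
  set V := (Sz (n - e)).map (LinearMap.mulRight ℂ b) with hV
  have h1 : (Sz n ⊓ LinearMap.ker (rho a b t).toLinearMap : Submodule ℂ S) = U ⊔ V := by
    ext p
    constructor
    · rintro ⟨hp, hk⟩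
      obtain ⟨α, hα, β, hβ, rfl⟩ := H.pair_hom hp (H.ker hp hk)
      exact Submodule.add_mem_sup ⟨α, hα, rfl⟩ ⟨β, hβ, rfl⟩
    · intro hp
      obtain ⟨_, ⟨α, hα, rfl⟩, _, ⟨β, hβ, rfl⟩, rfl⟩ := Submodule.mem_sup.mp hp
      refine ⟨Submodule.add_mem _ ?_ ?_, ?_⟩
      · have := Sz_mul hα H.ha
        rwa [sub_add_cancel] at this
      · have := Sz_mul hβ H.hb
        rwa [sub_add_cancel] at this
      · change rho a b t (α * a + β * b) = 0
        apply rho_I0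
        rw [Ideal.mem_span_pair]
        exact ⟨α, β, rfl⟩
  have h2 : U ⊓ V = (Sz (n - 2 * e)).map (LinearMap.mulRight ℂ (b * a)) := by
    ext p
    constructor
    · rintro ⟨⟨α, hα, rfl⟩, ⟨β, hβ, h⟩⟩
      have h' : β * b = α * a := h
      obtain ⟨q, hq, _⟩ := relprime_syz (α := α) (β := -β) H.hab H.ha0 (by rw [← h']; ring)
      refine ⟨hz (n - 2 * e) q, hz_mem _ _, ?_⟩
      change hz (n - 2 * e) q * (b * a) = α * a
      rw [← mul_assoc]
      congr 1
      have := hz_mul H.hb (n - e) q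
      rw [← hq, hz_self hα] at this
      rw [this]; congr 3; ring
    · rintro ⟨q, hq, rfl⟩
      refine ⟨⟨q * b, ?_, ?_⟩, ⟨q * a, ?_, ?_⟩⟩
      · have := Sz_mul hq H.hb
        rwa [show n - 2 * e + e = n - e by ring] at this
      · change q * b * a = q * (b * a); ring
      · have := Sz_mul hq H.ha
        rwa [show n - 2 * e + e = n - e by ring] at this
      · change q * a * b = q * (b * a); ring
  have h3 := Submodule.finrank_sup_add_finrank_inf_eq U V
  rw [h1]
  have hu := finrank_map_mul H.ha0 (n - e)
  have hv := finrank_map_mul H.hb0 (n - e)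
  have huv := finrank_map_mul (mul_ne_zero H.hb0 H.ha0) (n - 2 * e)
  rw [← hU] at hu
  rw [← hV] at hv
  rw [← h2] at huv
  omega

lemma Setup.finrank_F (H : Setup a b e t) (n : ℤ) :
    (Module.finrank ℂ (F a b t n) : ℤ) = sg n - 2 * sg (n - e) + sg (n - 2 * e) := by
  have h1 := finrank_map_inf (rho a b t).toLinearMap (Sz n)
  have h2 := H.finrank_I0 n
  have h3 := finrank_Sz n
  change Module.finrank ℂ (F a b t n) + _ = _ at h1
  omega

lemma Setup.finrank_F_ge (H : Setup a b e t) {n : ℤ} (hn : 2 * e - 2 ≤ n) :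
    (Module.finrank ℂ (F a b t n) : ℤ) = e ^ 2 := by
  rw [H.finrank_F]
  have he := H.he
  have h1 := sg_eq (k := n) (by omega)
  have h2 := sg_eq (k := n - e) (by omega)
  have h3 := sg_eq (k := n - 2 * e) (by omega)
  nlinarith

lemma Setup.finrank_F_pred (H : Setup a b e t) :
    (Module.finrank ℂ (F a b t (2 * e - 3)) : ℤ) = e ^ 2 - 1 := by
  rw [H.finrank_F]
  have he := H.he
  have h1 := sg_eq (k := 2 * e - 3) (by omega)
  have h2 := sg_eq (k := 2 * e - 3 - e) (by omega)
  have h3 := sg_neg (k := 2 * e - 3 - 2 * e) (by omega)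
  nlinarith

lemma Setup.F_top (H : Setup a b e t) {n : ℤ} (hn : 2 * e - 2 ≤ n) : F a b t n = ⊤ := by
  rw [eq_top_iff]
  intro x _
  obtain ⟨m, hm⟩ := mem_some_F x
  rcases le_total (m : ℤ) n with h | h
  · exact F_mono h hm
  · have := Submodule.eq_of_le_of_finrank_eq (F_mono (a := a) (b := b) (t := t) h) (by
      have h1 := H.finrank_F_ge hn
      have h2 := H.finrank_F_ge (hn.trans h)
      omega)
    rwa [this]

lemma Setup.fd (H : Setup a b e t) : FiniteDimensional ℂ (Bq a b t) := by
  have : FiniteDimensional ℂ (⊤ : Submodule ℂ (Bq a b t)) := by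
    rw [← H.F_top le_rfl]; infer_instance
  exact Module.finite_def.mpr (Module.Finite.iff_fg.mp this)

lemma Setup.step (H : Setup a b e t) {n : ℤ} {p : S} (hp : p ∈ Sz n) (i : Fin 3)
    (h : rho a b t (X i * p) ∈ F a b t n) : ∃ q α β : S,
    α ∈ Sz (n + 1 - e) ∧ β ∈ Sz (n + 1 - e) ∧ X i * p = α * a + β * b + ell t * q := by
  obtain ⟨q, hq, h⟩ := mem_F.mp h
  have h1 : X i * p - ell t * q ∈ Sz (n + 1) := by
    apply Submodule.sub_mem _ _ (ell_mul_mem t hq)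
    rw [mul_comm]; exact Sz_mul hp (X_mem_Sz i)
  have h2 : rho a b t (X i * p - ell t * q) = 0 := by
    rw [map_sub, ← h, map_mul, rho_ell, one_mul, sub_self]
  obtain ⟨α, hα, β, hβ, h3⟩ := H.pair_hom h1 (H.ker h1 h2)
  exact ⟨q, α, β, hα, hβ, by linear_combination h3⟩

lemma Setup.socle (H : Setup a b e t) {n : ℤ} (hn : n < 2 * e - 2) {p : S} (hp : p ∈ Sz n)
    (h0 : rho a b t (X 0 * p) ∈ F a b t n) (h1 : rho a b t (X 1 * p) ∈ F a b t n) :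
    rho a b t p ∈ F a b t (n - 1) := by
  obtain ⟨q0, α0, β0, hα0, hβ0, e0⟩ := H.step hp 0 h0
  obtain ⟨q1, α1, β1, hα1, hβ1, e1⟩ := H.step hp 1 h1
  have hI : X 0 * q1 - X 1 * q0 ∈ Ideal.span {a, b} := by
    apply H.ht
    rw [Ideal.mem_span_pair]
    exact ⟨X 1 * α0 - X 0 * α1, X 1 * β0 - X 0 * β1, by
      linear_combination X 0 * e1 - X 1 * e0⟩
  rw [Ideal.mem_span_pair] at hI
  obtain ⟨u, v, huv⟩ := hI
  obtain ⟨q, hq1, hq2⟩ := relprime_syz (α := X 1 * α0 - X 0 * α1 - u * ell t)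
    (β := X 1 * β0 - X 0 * β1 - v * ell t) H.hab H.ha0 (by
      linear_combination X 0 * e1 - X 1 * e0 - ell t * huv)
  have hmem : ∀ x y : S, x ∈ Sz (n + 1 - e) → y ∈ Sz (n + 1 - e) →
      X 1 * x - X 0 * y ∈ Sz (n + 1 - e + 1) := by
    intro x y hx hy
    apply Submodule.sub_mem
    · rw [mul_comm]; exact Sz_mul hx (X_mem_Sz 1)
    · rw [mul_comm]; exact Sz_mul hy (X_mem_Sz 0)
  have hA := congrArg (hz (n + 1 - e + 1)) hq1
  rw [map_sub, hz_self (hmem _ _ hα0 hα1), hz_mul (ell_mem t), hz_mul H.hb,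
    hz_neg (show n + 1 - e + 1 - e < 0 by omega), LinearMap.zero_apply, zero_mul] at hA
  have hB := congrArg (hz (n + 1 - e + 1)) hq2
  rw [map_sub, hz_self (hmem _ _ hβ0 hβ1), hz_mul (ell_mem t), hz_mul H.ha,
    hz_neg (show n + 1 - e + 1 - e < 0 by omega), LinearMap.zero_apply, zero_mul] at hB
  have pA := congrArg (pim t) hA
  have pB := congrArg (pim t) hB
  simp only [map_sub, map_mul, pim_0, pim_1, pim_ell, mul_zero, sub_zero, map_zero] at pA pB
  obtain ⟨u', hu'⟩ := X_dvd_of_X_mul (i := 1) (j := 0) (by decide) (sub_eq_zero.mp pA)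
  obtain ⟨v', hv'⟩ := X_dvd_of_X_mul (i := 1) (j := 0) (by decide) (sub_eq_zero.mp pB)
  have p0 := congrArg (pim t) e0
  simp only [map_add, map_mul, pim_0, pim_ell, zero_mul, add_zero, hu', hv'] at p0
  have p1 : pim t p = u' * pim t a + v' * pim t b := by
    apply mul_left_cancel₀ (X_ne_zero (R := ℂ) (0 : Fin 3))
    linear_combination p0
  obtain ⟨r, hr⟩ := pim_sub t p
  obtain ⟨ra, hra⟩ := pim_sub t a
  obtain ⟨rb, hrb⟩ := pim_sub t b
  have hfin : p = u' * a + v' * b + (r - u' * ra - v' * rb) * ell t := by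
    linear_combination hr + p1 - u' * hra - v' * hrb
  have := congrArg (hz n) hfin
  rw [hz_self hp, map_add, map_add, hz_mul H.ha, hz_mul H.hb, hz_mul (ell_mem t)] at this
  refine mem_F.mpr ⟨hz (n - 1) (r - u' * ra - v' * rb), hz_mem _ _, ?_⟩
  have hz0 : rho a b t (hz (n - e) u' * a + hz (n - e) v' * b) = 0 :=
    rho_I0 (by rw [Ideal.mem_span_pair]; exact ⟨_, _, rfl⟩)
  conv_rhs => rw [this]
  rw [map_add, hz0, map_mul, rho_ell, mul_one, zero_add]

lemma Setup.pair (H : Setup a b e t) (j : ℕ) : ∀ x : Bq a b t, x ∈ F a b t (2 * e - 2 - j) →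
    x ∉ F a b t (2 * e - 2 - j - 1) → ∃ y ∈ F a b t j, x * y ∉ F a b t (2 * e - 3) := by
  induction j with
  | zero =>
    intro x hx hx'
    refine ⟨1, one_mem_F, ?_⟩
    rw [mul_one]
    convert hx' using 2
    push_cast; ring
  | succ j ih =>
    intro x hx hx'
    obtain ⟨p, hp, rfl⟩ := mem_F.mp hx
    have hi : ∃ i, rho a b t (X i * p) ∉ F a b t (2 * e - 2 - (j + 1 : ℕ)) := by
      by_contra! hall
      exact hx' (H.socle (by push_cast; omega) hp (hall 0) (hall 1))
    obtain ⟨i, hi⟩ := hi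
    have h1 : 2 * e - 2 - ((j + 1 : ℕ) : ℤ) = 2 * e - 2 - j - 1 := by push_cast; ring
    have h2 : rho a b t (X i * p) ∈ F a b t (2 * e - 2 - j) := by
      refine mem_F.mpr ⟨X i * p, ?_, rfl⟩
      have := Sz_mul hp (X_mem_Sz i)
      rw [mul_comm (X i) p]
      rwa [h1, sub_add_cancel] at this
    rw [h1] at hi
    obtain ⟨y, hy, hy'⟩ := ih _ h2 hi
    refine ⟨rho a b t (X i) * y, ?_, ?_⟩
    · have := F_mul (mem_F.mpr ⟨X i, X_mem_Sz i, rfl⟩) hy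
      push_cast; rwa [add_comm] at this
    · rw [map_mul] at hy'
      rwa [← mul_assoc, mul_comm (rho a b t p)]

lemma Setup.exists_phi (H : Setup a b e t) : ∃ φ : Bq a b t →ₗ[ℂ] ℂ,
    LinearMap.ker φ = F a b t (2 * e - 3) := by
  have := H.fd
  have h1 : Module.finrank ℂ (Bq a b t ⧸ F a b t (2 * e - 3)) = Module.finrank ℂ ℂ := by
    have h1 := Submodule.finrank_quotient_add_finrank (F a b t (2 * e - 3))
    have h2 := H.finrank_F_pred
    have h3 := H.finrank_F_ge le_rfl
    rw [H.F_top le_rfl, finrank_top] at h3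
    rw [Module.finrank_self]
    omega
  let E := LinearEquiv.ofFinrankEq _ _ h1
  refine ⟨E.toLinearMap ∘ₗ (F a b t (2 * e - 3)).mkQ, ?_⟩
  rw [LinearEquiv.ker_comp, Submodule.ker_mkQ]

lemma Setup.duality (H : Setup a b e t) (φ : Bq a b t →ₗ[ℂ] ℂ)
    (hφ : LinearMap.ker φ = F a b t (2 * e - 3)) (n : ℤ) (x : Bq a b t) :
    (∀ y ∈ F a b t n, φ (y * x) = 0) ↔ x ∈ F a b t (2 * e - 3 - n) := by
  constructor
  · intro h
    by_contra hx
    -- find the largest j with x in F (2e-2-j)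
    have hex : ∃ j : ℕ, x ∉ F a b t (2 * e - 2 - j - 1) := by
      by_contra! hall
      have h0 := hall (2 * e).toNat
      rw [F_neg (by have := H.he; omega)] at h0
      rw [(Submodule.mem_bot _).mp h0] at hx
      exact hx (Submodule.zero_mem _)
    classical
    let j := Nat.find hex
    have hj : x ∉ F a b t (2 * e - 2 - j - 1) := Nat.find_spec hex
    have hj' : x ∈ F a b t (2 * e - 2 - j) := by
      rcases Nat.eq_zero_or_pos j with h0 | h0
      · rw [h0, H.F_top (by simp)]; trivial
      · have := Nat.find_min hex (m := j - 1) (by omega)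
        rw [not_not] at this
        convert this using 2
        omega
    obtain ⟨y, hy, hxy⟩ := H.pair j x hj' hj
    rw [← hφ] at hxy
    apply hxy
    rw [LinearMap.mem_ker, mul_comm]
    apply h
    refine F_mono ?_ hy
    by_contra hlt
    exact hx (F_mono (by omega) hj')
  · intro hx y hy
    have := F_mul hy hx
    rw [← LinearMap.mem_ker, hφ]
    convert this using 2
    ring
end setup

lemma la_lemma {B : Type*} [CommRing B] [Algebra ℂ B] [FiniteDimensional ℂ B] (φ : B →ₗ[ℂ] ℂ)
    (hφ : ∀ x, (∀ y, φ (y * x) = 0) → x = 0) (U V : Submodule ℂ B)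
    (hUV : ∀ x, (∀ y ∈ U, φ (y * x) = 0) ↔ x ∈ V) :
    Module.finrank ℂ U + Module.finrank ℂ V = Module.finrank ℂ B ∧
    ∀ γ : B, Module.finrank ℂ (V.map (LinearMap.mulRight ℂ γ)) +
      Module.finrank ℂ (U ⊓ LinearMap.range (LinearMap.mulRight ℂ γ) : Submodule ℂ B)
      = Module.finrank ℂ (LinearMap.range (LinearMap.mulRight ℂ γ)) := by
  let β : LinearMap.BilinForm ℂ B := (LinearMap.mul ℂ B).compr₂ φ
  have hβ : ∀ x y, β x y = φ (x * y) := fun x y => rfl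
  have hrefl : β.IsRefl := by
    intro x y h
    rw [hβ] at h ⊢
    rwa [mul_comm]
  have hnd : β.Nondegenerate := by
    constructor
    · intro x h
      exact hφ x (fun y => by rw [mul_comm]; exact h y)
    · intro x h
      exact hφ x h
  have hV : β.orthogonal U = V := by
    ext x
    rw [← hUV]; rfl
  have key : ∀ W : Submodule ℂ B, Module.finrank ℂ W + Module.finrank ℂ (β.orthogonal W)
      = Module.finrank ℂ B := by
    intro W
    have h1 := LinearMap.BilinForm.finrank_orthogonal hnd W
    have h2 := Submodule.finrank_le W
    omega
  refine ⟨by rw [← hV]; exact key U, fun γ => ?_⟩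
  set G := LinearMap.mulRight ℂ γ with hG
  have h1 : β.orthogonal (V.map G) = U.comap G := by
    ext x
    have hU : G x ∈ U ↔ G x ∈ β.orthogonal V := by
      rw [← hV, LinearMap.BilinForm.orthogonal_orthogonal hnd hrefl]
    rw [Submodule.mem_comap, hU]
    constructor
    · intro h y hy
      have := h (G y) ⟨y, hy, rfl⟩
      change φ (y * γ * x) = 0 at this
      change φ (y * (x * γ)) = 0
      rw [← this]; congr 1; ring
    · rintro h _ ⟨y, hy, rfl⟩
      have := h y hy
      change φ (y * (x * γ)) = 0 at this
      change φ (y * γ * x) = 0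
      rw [← this]; congr 1; ring
  have h2 := key (V.map G)
  rw [h1] at h2
  have h3 := finrank_map_inf G (U.comap G)
  have h4 : U.comap G ⊓ LinearMap.ker G = LinearMap.ker G := by
    rw [inf_eq_right]
    intro x hx
    rw [Submodule.mem_comap, LinearMap.mem_ker.mp hx]; exact U.zero_mem
  rw [h4, Submodule.map_comap_eq, inf_comm] at h3
  have h5 := LinearMap.finrank_range_add_finrank_ker G
  omega

lemma mdimZ_eq (f : S) (k : ℤ) : mdimZ f k = Module.finrank ℂ ((Sz k).map (quotC f)) := by
  rcases int_cases k with ⟨n, rfl⟩ | h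
  · rw [Sz_nat]; simp [mdimZ, mdim, Msub, Sgr]; rfl
  · rw [Sz_neg h, Submodule.map_bot, finrank_bot]; simp [mdimZ, not_le.mpr h]

lemma ndimZ_eq (f : S) (k : ℤ) : ndimZ f k =
    Module.finrank ℂ (((Isat f).restrictScalars ℂ ⊓ Sz k).map (quotC f)) := by
  rcases int_cases k with ⟨n, rfl⟩ | h
  · rw [Sz_nat]; simp [ndimZ, ndim, Nsub, Sgr]; rfl
  · rw [Sz_neg h, inf_bot_eq, Submodule.map_bot, finrank_bot]; simp [ndimZ, not_le.mpr h]

lemma mem_ker_quotC {f p : S} : p ∈ LinearMap.ker (quotC f) ↔ p ∈ Jf f := by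
  rw [LinearMap.mem_ker]
  exact Submodule.Quotient.mk_eq_zero _

lemma mem_Isat {f p : S} : p ∈ Isat f ↔ ∃ n : ℕ, ∀ u ∈ mId ^ n, p * u ∈ Jf f := by
  unfold Isat
  rw [Submodule.mem_iSup_of_directed]
  · simp only [Submodule.mem_colon]; rfl
  · apply Monotone.directed_le
    intro m n h
    apply Submodule.colon_mono le_rfl
    exact Ideal.pow_le_pow_right h

lemma mId_eq : mId = MvPolynomial.idealOfVars (Fin 3) ℂ := by
  unfold mId MvPolynomial.idealOfVars
  congr 1
  ext x
  simp [Fin.exists_fin_succ, eq_comm]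

section asm
variable {a b c f : S} {e : ℤ} {t : ℂ}

lemma mem_J (hJ : Jf f = Ideal.span {c, a, b}) {p : S} :
    p ∈ Jf f ↔ ∃ q, ∃ z ∈ Ideal.span {a, b}, p = q * c + z := by
  rw [hJ, Ideal.mem_span_insert]

lemma Setup.map_J (H : Setup a b e t) (hc : c ∈ Sz e) (hJ : Jf f = Ideal.span {c, a, b}) (k : ℤ) :
    (Sz k ⊓ (Jf f).restrictScalars ℂ).map (rho a b t).toLinearMap
      = (F a b t (k - e)).map (LinearMap.mulRight ℂ (rho a b t c)) := by
  ext x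
  constructor
  · rintro ⟨p, ⟨hp, hpJ⟩, rfl⟩
    obtain ⟨q, z, hz', h⟩ := (mem_J hJ).mp hpJ
    have h1 := congrArg (hz k) h
    rw [hz_self hp, map_add, hz_mul hc] at h1
    refine ⟨rho a b t (hz (k - e) q), mem_F.mpr ⟨_, hz_mem _ _, rfl⟩, ?_⟩
    change rho a b t (hz (k - e) q) * rho a b t c = rho a b t p
    rw [h1, map_add, rho_I0 (H.I0_hom hz' k), add_zero, map_mul]
  · rintro ⟨_, ⟨q, hq, rfl⟩, rfl⟩
    refine ⟨q * c, ⟨?_, (mem_J hJ).mpr ⟨q, 0, by simp, by simp⟩⟩, ?_⟩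
    · have := Sz_mul hq hc
      rwa [sub_add_cancel] at this
    · change rho a b t (q * c) = rho a b t q * rho a b t c
      rw [map_mul]

lemma Setup.dim_W (H : Setup a b e t) (hc : c ∈ Sz e) (hJ : Jf f = Ideal.span {c, a, b}) (k : ℤ)
    (W : Submodule ℂ S) (hW : W ≤ Sz k) (hW' : Sz k ⊓ (Jf f).restrictScalars ℂ ≤ W) :
    Module.finrank ℂ (W.map (quotC f)) +
      Module.finrank ℂ ((F a b t (k - e)).map (LinearMap.mulRight ℂ (rho a b t c)))
      = Module.finrank ℂ (W.map (rho a b t).toLinearMap) := by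
  have : FiniteDimensional ℂ W := Submodule.finiteDimensional_of_le hW
  have hfd : FiniteDimensional ℂ (Sz k ⊓ (Jf f).restrictScalars ℂ : Submodule ℂ S) :=
    Submodule.finiteDimensional_of_le hW'
  have h1 := finrank_map_inf (quotC f) W
  have h2 := finrank_map_inf (rho a b t).toLinearMap W
  have h3 := finrank_map_inf (rho a b t).toLinearMap (Sz k ⊓ (Jf f).restrictScalars ℂ)
  have e1 : W ⊓ LinearMap.ker (quotC f) = Sz k ⊓ (Jf f).restrictScalars ℂ := by
    ext p
    constructor
    · rintro ⟨h, h'⟩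
      exact ⟨hW h, mem_ker_quotC.mp h'⟩
    · intro h
      exact ⟨hW' h, mem_ker_quotC.mpr h.2⟩
  have e2 : W ⊓ LinearMap.ker (rho a b t).toLinearMap =
      Sz k ⊓ (Jf f).restrictScalars ℂ ⊓ LinearMap.ker (rho a b t).toLinearMap := by
    ext p
    constructor
    · rintro ⟨h, h'⟩
      exact ⟨⟨hW h, (mem_J hJ).mpr ⟨0, p, H.ker (hW h) h', by simp⟩⟩, h'⟩
    · rintro ⟨h, h'⟩
      exact ⟨hW' h, h'⟩
  rw [H.map_J hc hJ] at h3
  rw [e1] at h1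
  rw [e2] at h2
  omega

lemma Setup.mem_sat (H : Setup a b e t) (hc : c ∈ Sz e) (hJ : Jf f = Ideal.span {c, a, b}) {k : ℤ}
    {p : S} (hp : p ∈ Sz k) :
    p ∈ Isat f ↔ rho a b t p ∈ LinearMap.range (LinearMap.mulRight ℂ (rho a b t c)) := by
  rw [mem_Isat]
  constructor
  · rintro ⟨n, h⟩
    have hl : ell t ^ n ∈ mId ^ n := by
      apply Ideal.pow_mem_pow
      unfold ell mId
      refine Ideal.add_mem _ (Ideal.add_mem _ ?_ ?_) ?_
      · exact Ideal.subset_span (by simp)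
      · exact Ideal.mul_mem_left _ _ (Ideal.subset_span (by simp))
      · exact Ideal.mul_mem_left _ _ (Ideal.subset_span (by simp))
    obtain ⟨q, z, hz', h1⟩ := (mem_J hJ).mp (h _ hl)
    refine ⟨rho a b t q, ?_⟩
    have := congrArg (rho a b t) h1
    rw [map_mul, map_pow, rho_ell, one_pow, mul_one, map_add, rho_I0 hz', add_zero, map_mul] at this
    exact this.symm
  · rintro ⟨y, hy⟩
    have hy : y * rho a b t c = rho a b t p := hy
    obtain ⟨n, hn⟩ : ∃ n : ℕ, 2 * e - 2 ≤ k + n - e := ⟨(3 * e - k).toNat, by omega⟩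
    refine ⟨n, fun u hu => ?_⟩
    rw [mId_eq, MvPolynomial.pow_idealOfVars_eq_span] at hu
    induction hu using Submodule.span_induction with
    | zero => simp
    | add x y _ _ hx hy => rw [mul_add]; exact Ideal.add_mem _ hx hy
    | smul r x _ hx =>
      rw [smul_eq_mul, mul_left_comm]; exact Ideal.mul_mem_left _ _ hx
    | mem u hu =>
      have hu' : u ∈ Sz n := by
        obtain ⟨m, hm, rfl⟩ := hu
        rw [Sz_nat, mem_homogeneousSubmodule]
        apply isHomogeneous_monomial
        rw [← hm]
      have h1 : y * rho a b t u ∈ F a b t (k + n - e) := by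
        rw [H.F_top hn]; trivial
      obtain ⟨q, hq, h2⟩ := mem_F.mp h1
      have h3 : p * u - q * c ∈ Sz (k + n) := by
        apply Submodule.sub_mem _ (Sz_mul hp hu')
        have := Sz_mul hq hc
        rwa [sub_add_cancel] at this
      have h4 : rho a b t (p * u - q * c) = 0 := by
        rw [map_sub, map_mul, map_mul, h2, ← hy]; ring
      exact (mem_J hJ).mpr ⟨q, _, H.ker h3 h4, by ring⟩

lemma Setup.map_sat (H : Setup a b e t) (hc : c ∈ Sz e) (hJ : Jf f = Ideal.span {c, a, b}) (k : ℤ) :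
    ((Isat f).restrictScalars ℂ ⊓ Sz k).map (rho a b t).toLinearMap
      = F a b t k ⊓ LinearMap.range (LinearMap.mulRight ℂ (rho a b t c)) := by
  ext x
  constructor
  · rintro ⟨p, ⟨h1, h2⟩, rfl⟩
    exact ⟨mem_F.mpr ⟨p, h2, rfl⟩, (H.mem_sat hc hJ h2).mp h1⟩
  · rintro ⟨⟨p, hp, rfl⟩, h2⟩
    exact ⟨p, ⟨(H.mem_sat hc hJ hp).mpr h2, hp⟩, rfl⟩

lemma Setup.main (H : Setup a b e t) (hc : c ∈ Sz e) (hJ : Jf f = Ideal.span {c, a, b})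
    {τ : ℕ} (hτ : TjurinaIs f τ) (k : ℤ) :
    ndimZ f k = mdimZ f k + mdimZ f (3 * e - 3 - k) -
      (sg k - 3 * sg (k - e) + 3 * sg (k - 2 * e) - sg (k - 3 * e)) - τ := by
  have hfd := H.fd
  obtain ⟨φ, hφ⟩ := H.exists_phi
  have hnd : ∀ x, (∀ y, φ (y * x) = 0) → x = 0 := by
    intro x hx
    have := (H.duality φ hφ (2 * e - 2) x).mp (fun y _ => hx y)
    rw [F_neg (by omega)] at this
    exact (Submodule.mem_bot _).mp this
  have hm : ∀ j : ℤ, mdimZ f j +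
      Module.finrank ℂ ((F a b t (j - e)).map (LinearMap.mulRight ℂ (rho a b t c)))
      = Module.finrank ℂ (F a b t j) := by
    intro j
    rw [mdimZ_eq]
    exact_mod_cast H.dim_W hc hJ j (Sz j) le_rfl inf_le_left
  have hn : ndimZ f k +
      Module.finrank ℂ ((F a b t (k - e)).map (LinearMap.mulRight ℂ (rho a b t c)))
      = Module.finrank ℂ (F a b t k ⊓ LinearMap.range (LinearMap.mulRight ℂ (rho a b t c)) :
        Submodule ℂ (Bq a b t)) := by
    rw [ndimZ_eq, ← H.map_sat hc hJ]
    refine mod_cast H.dim_W hc hJ k _ inf_le_right (le_inf ?_ inf_le_left)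
    rintro p ⟨_, hp⟩
    exact mem_Isat.mpr ⟨0, fun u _ => Ideal.mul_mem_right _ _ hp⟩
  have ht : (τ : ℤ) + Module.finrank ℂ (LinearMap.range (LinearMap.mulRight ℂ (rho a b t c)))
      = Module.finrank ℂ (Bq a b t) := by
    obtain ⟨N, hN⟩ := hτ
    let M : ℕ := N + (3 * e).toNat
    have h1 := hm M
    rw [H.F_top (n := (M : ℤ) - e) (by omega), H.F_top (n := (M : ℤ)) (by have := H.he; omega),
      Submodule.map_top, finrank_top] at h1
    rw [← h1, ← hN M (by omega)]
    simp [mdimZ]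
  have d1 := (la_lemma φ hnd (F a b t (k - e)) _ (H.duality φ hφ (k - e))).1
  have d2 := (la_lemma φ hnd (F a b t k) _ (H.duality φ hφ k)).2 (rho a b t c)
  have h1 := hm k
  have h2 := hm (3 * e - 3 - k)
  rw [show 2 * e - 3 - (k - e) = 3 * e - 3 - k by ring] at d1
  rw [show 3 * e - 3 - k - e = 2 * e - 3 - k by ring] at h2
  have f1 := H.finrank_F k
  have f2 := H.finrank_F (k - e)
  rw [show k - e - e = k - 2 * e by ring, show k - e - 2 * e = k - 3 * e by ring] at f2
  omega
end asm

lemma span_rot (u v w : S) : ({u, v, w} : Set S) = {v, w, u} := by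
  ext x; simp only [Set.mem_insert_iff, Set.mem_singleton_iff]; tauto

lemma choose_abc {f : S} {e : ℤ} (he : 1 ≤ e) {g0 g1 g2 : S} (m0 : g0 ∈ Sz e) (m1 : g1 ∈ Sz e)
    (m2 : g2 ∈ Sz e) (hJ : Jf f = Ideal.span {g0, g1, g2}) (h0 : g0 ≠ 0)
    (hc : ∀ p : S, Prime p → ¬ (p ∣ g0 ∧ p ∣ g1 ∧ p ∣ g2)) :
    ∃ a b c t, Setup a b e t ∧ c ∈ Sz e ∧ Jf f = Ideal.span {c, a, b} := by
  obtain ⟨s, hs⟩ := exists_comb h0 hc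
  obtain ⟨t, ht⟩ := exists_ell hs h0
  refine ⟨g0, g1 + C s * g2, g2, t, ⟨he, m0, ?_, h0, ?_, hs, ht⟩, m2, ?_⟩
  · exact Submodule.add_mem _ m1 (C_mul_Sz s m2)
  · intro hb
    rw [hb] at hs
    have hu : IsUnit g0 := hs dvd_rfl (dvd_zero _)
    obtain ⟨v, hv⟩ := hu.exists_right_inv
    have h1 := hz_mul m0 0 v
    rw [mul_comm, hv, hz_self one_mem_Sz, hz_neg (by omega)] at h1
    simp at h1
  · rw [hJ]
    apply le_antisymm
    · rw [Ideal.span_le]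
      rintro x (rfl | rfl | rfl)
      · exact Ideal.subset_span (by simp)
      · have h1 : x + C s * g2 ∈ Ideal.span {g2, g0, x + C s * g2} := Ideal.subset_span (by simp)
        have h2 : g2 ∈ Ideal.span {g2, g0, x + C s * g2} := Ideal.subset_span (by simp)
        have := Ideal.sub_mem _ h1 (Ideal.mul_mem_left _ (C s) h2)
        rwa [add_sub_cancel_right] at this
      · exact Ideal.subset_span (by simp)
    · rw [Ideal.span_le]
      rintro x (rfl | rfl | rfl)
      · exact Ideal.subset_span (by simp)
      · exact Ideal.subset_span (by simp)
      · exact Ideal.add_mem _ (Ideal.subset_span (by simp))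
          (Ideal.mul_mem_left _ _ (Ideal.subset_span (by simp)))

lemma two_le {f : S} {d : ℕ} (hhom : f.IsHomogeneous d) (hnc : ¬ IsConeOfLines f) : 2 ≤ d := by
  by_contra hd
  apply hnc
  have hd : d = 0 ∨ d = 1 := by omega
  rcases hd with rfl | rfl
  · refine ⟨fun _ => 1, fun h => by simpa using congrFun h 0, coeff 0 f, 0, by simp, ?_⟩
    rw [Multiset.prod_zero, mul_one]
    exact totalDegree_eq_zero_iff_eq_C.mp (hhom.totalDegree_le.antisymm (Nat.zero_le _))
  · have hq : ∃ q : Fin 3 → ℂ, q ≠ 0 ∧ eval q f = 0 := by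
      have hE := hhom.sum_X_mul_pderiv
      have hp : ∀ i, ∃ c : ℂ, pderiv i f = C c := fun i =>
        ⟨_, totalDegree_eq_zero_iff_eq_C.mp ((hhom.pderiv (i := i)).totalDegree_le.antisymm (Nat.zero_le _))⟩
      choose c hc using hp
      have hf : ∀ q : Fin 3 → ℂ, eval q f = q 0 * c 0 + q 1 * c 1 + q 2 * c 2 := by
        intro q
        have := congrArg (eval q) hE
        simp [Fin.sum_univ_three, hc] at this
        exact this.symm
      by_cases h : c 0 = 0
      · refine ⟨![1, 0, 0], fun h => by simpa using congrFun h 0, ?_⟩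
        rw [hf]; simp [h]
      · refine ⟨![c 1, - c 0, 0], fun h' => h (by simpa using congrFun h' 1), ?_⟩
        rw [hf]; simp; ring
    obtain ⟨q, hq, hq'⟩ := hq
    refine ⟨q, hq, 1, {f}, ?_, by simp⟩
    intro l hl
    rw [Multiset.mem_singleton.mp hl]
    exact ⟨hhom, hq'⟩

lemma exists_setup {f : S} {d : ℕ} (hhom : f.IsHomogeneous d) (hred : Squarefree f) (hd : 2 ≤ d) :
    ∃ a b c t, Setup a b ((d : ℤ) - 1) t ∧ c ∈ Sz ((d : ℤ) - 1) ∧ Jf f = Ideal.span {c, a, b} := by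
  have hm : ∀ i, pderiv i f ∈ Sz ((d : ℤ) - 1) := by
    intro i
    have : (d : ℤ) - 1 = ((d - 1 : ℕ) : ℤ) := by omega
    rw [this, Sz_nat]
    exact hhom.pderiv
  have hp : ∀ p : S, Prime p → ¬ (p ∣ pderiv 0 f ∧ p ∣ pderiv 1 f ∧ p ∣ pderiv 2 f) := by
    rintro p hp ⟨h0, h1, h2⟩
    refine no_common_prime (by omega) hhom hred hp (fun i => ?_)
    fin_cases i
    · exact h0
    · exact h1
    · exact h2
  have he : (1 : ℤ) ≤ (d : ℤ) - 1 := by omega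
  by_cases h0 : pderiv 0 f = 0
  · by_cases h1 : pderiv 1 f = 0
    · by_cases h2 : pderiv 2 f = 0
      · exact absurd ⟨h0 ▸ dvd_zero _, h1 ▸ dvd_zero _, h2 ▸ dvd_zero _⟩ (hp (X 0) X_prime)
      · exact choose_abc he (hm 2) (hm 0) (hm 1) (by rw [Jf, span_rot, span_rot]) h2
          (fun p hpp h => hp p hpp ⟨h.2.1, h.2.2, h.1⟩)
    · exact choose_abc he (hm 1) (hm 2) (hm 0) (by rw [Jf, span_rot]) h1
        (fun p hpp h => hp p hpp ⟨h.2.2, h.1, h.2.1⟩)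
  · exact choose_abc he (hm 0) (hm 1) (hm 2) rfl h0 hp


theorem stmt13 (f : S) (d : ℕ) (hhom : f.IsHomogeneous d) (hred : Squarefree f)
    (hnc : ¬ IsConeOfLines f) (τ : ℕ) (hτ : TjurinaIs f τ) :
    ∀ k : ℤ, ndimZ f k
      = mdimZ f k + mdimZ f (3 * ((d : ℤ) - 2) - k) - msHilbZ d k - (τ : ℤ) := by
  intro k
  have hd := two_le hhom hnc
  obtain ⟨a, b, c, t, H, hc, hJ⟩ := exists_setup hhom hred hd
  rw [ms_eq d (by omega) k, H.main hc hJ hτ k]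
  rw [show 3 * ((d : ℤ) - 1) - 3 - k = 3 * ((d : ℤ) - 2) - k by ring]

end
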